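/- Let X_1,…,X_{K+1} be mutually independent finitely-valued random variables and let (X_1,…,X_{K+1},Y) be jointly distributed, with 𝒦 = {1,…,K}. Then for every S ⊆ 𝒦, I(X_{S∪{K+1}};Y|X_{𝒦∖S}) ≤ I(X_S;Y|X_{(𝒦∖S)∪{K+1}}) + I(X_{K+1};Y|X_𝒦). -/

import Mathlib

open scoped Classical

noncomputable section

/-- Probability that random variable `X` takes value `x`, under pmf `p` on a finite sample space. -/
def probOf {Ω α : Type} [Fintype Ω] (p : Ω → ℝ) (X : Ω → α) (x : α) : ℝ :=
  ∑ ω, if X ω = x then p ω else 0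

/-- Shannon entropy of a finitely-valued random variable. -/
def Hent {Ω α : Type} [Fintype Ω] [Fintype α] (p : Ω → ℝ) (X : Ω → α) : ℝ :=
  -∑ x, probOf p X x * Real.log (probOf p X x)

/-- Conditional entropy `H(X | C)`. -/
def condHent {Ω α γ : Type} [Fintype Ω] [Fintype α] [Fintype γ]
    (p : Ω → ℝ) (X : Ω → α) (C : Ω → γ) : ℝ :=
  Hent p (fun ω => (X ω, C ω)) - Hent p C

/-- Conditional mutual information `I(A;B | C)`. -/
def IcondMut {Ω α β γ : Type} [Fintype Ω] [Fintype α] [Fintype β] [Fintype γ]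
    (p : Ω → ℝ) (A : Ω → α) (B : Ω → β) (C : Ω → γ) : ℝ :=
  condHent p A C + condHent p B C - condHent p (fun ω => (A ω, B ω)) C

/-- Mutual information `I(A;B)`. -/
def Imut {Ω α β : Type} [Fintype Ω] [Fintype α] [Fintype β]
    (p : Ω → ℝ) (A : Ω → α) (B : Ω → β) : ℝ :=
  Hent p A + Hent p B - Hent p (fun ω => (A ω, B ω))

/-- `p` is a probability mass function. -/
def IsPMF {Ω : Type} [Fintype Ω] (p : Ω → ℝ) : Prop :=
  (∀ ω, 0 ≤ p ω) ∧ ∑ ω, p ω = 1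

/-- The tuple `X_S = (X_k)_{k ∈ S}` as a random variable. -/
def tup {Ω ι : Type} {𝒳 : ι → Type} (X : ∀ k, Ω → 𝒳 k) (S : Finset ι) :
    Ω → ∀ k : S, 𝒳 k.1 :=
  fun ω k => X k.1 ω

/-- The random variables `X_1, …, X_K` are mutually independent. -/
def MutIndep {Ω ι : Type} [Fintype Ω] [Fintype ι] {𝒳 : ι → Type} [∀ k, Fintype (𝒳 k)]
    (p : Ω → ℝ) (X : ∀ k, Ω → 𝒳 k) : Prop :=
  ∀ x : ∀ k, 𝒳 k, probOf p (fun ω k => X k ω) x = ∏ k, probOf p (X k) (x k)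

/-- An expectation of a function of `X` is a sum over the values of `X`. -/
lemma sum_mul_comp_eq_sum_probOf {Ω α : Type} [Fintype Ω] [Fintype α]
    (p : Ω → ℝ) (X : Ω → α) (f : α → ℝ) :
    ∑ ω, p ω * f (X ω) = ∑ x, probOf p X x * f x := by
  simp only [probOf, Finset.sum_mul, ite_mul, zero_mul]
  rw [Finset.sum_comm]
  simp

lemma sum_probOf {Ω α : Type} [Fintype Ω] [Fintype α] (p : Ω → ℝ) (X : Ω → α) :
    ∑ x, probOf p X x = ∑ ω, p ω := by
  simpa using (sum_mul_comp_eq_sum_probOf p X fun _ => 1).symm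

lemma sum_probOf_pair {Ω α β : Type} [Fintype Ω] [Fintype α]
    (p : Ω → ℝ) (X : Ω → α) (Z : Ω → β) (z : β) :
    ∑ x, probOf p (fun ω => (X ω, Z ω)) (x, z) = probOf p Z z := by
  simp only [probOf, Prod.mk.injEq, ite_and]
  rw [Finset.sum_comm]
  simp

lemma probOf_nonneg {Ω α : Type} [Fintype Ω] {p : Ω → ℝ} (hp : ∀ ω, 0 ≤ p ω)
    (X : Ω → α) (x : α) : 0 ≤ probOf p X x :=
  Finset.sum_nonneg fun ω _ => by split_ifs <;> simp [hp]

lemma le_probOf {Ω α : Type} [Fintype Ω] {p : Ω → ℝ} (hp : ∀ ω, 0 ≤ p ω)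
    (X : Ω → α) (ω : Ω) : p ω ≤ probOf p X (X ω) := by
  have := Finset.single_le_sum (f := fun ω' => if X ω' = X ω then p ω' else 0)
    (fun ω' _ => by split_ifs <;> simp [hp]) (Finset.mem_univ ω)
  simpa [probOf] using this

lemma Hent_eq_neg_sum {Ω α : Type} [Fintype Ω] [Fintype α] (p : Ω → ℝ) (X : Ω → α) :
    Hent p X = -∑ ω, p ω * Real.log (probOf p X (X ω)) := by
  rw [Hent, sum_mul_comp_eq_sum_probOf p X fun x => Real.log (probOf p X x)]

/-- Entropy only depends on the partition of the sample space induced by the random variable. -/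
lemma Hent_congr {Ω α β : Type} [Fintype Ω] [Fintype α] [Fintype β] (p : Ω → ℝ)
    {X : Ω → α} {Z : Ω → β} (h : ∀ ω ω', X ω = X ω' ↔ Z ω = Z ω') :
    Hent p X = Hent p Z := by
  simp only [Hent_eq_neg_sum, probOf, h]

/-- Submodularity of entropy. -/
lemma Hent_submodular {Ω α β γ : Type} [Fintype Ω] [Fintype α] [Fintype β] [Fintype γ]
    {p : Ω → ℝ} (hp : ∀ ω, 0 ≤ p ω) (U : Ω → α) (V : Ω → β) (W : Ω → γ) :
    Hent p (fun ω => (U ω, V ω, W ω)) + Hent p W ≤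
      Hent p (fun ω => (U ω, W ω)) + Hent p (fun ω => (V ω, W ω)) := by
  set UVW := fun ω => (U ω, V ω, W ω)
  set UW := fun ω => (U ω, W ω)
  set VW := fun ω => (V ω, W ω)
  let r : α × β × γ → ℝ := fun x =>
    probOf p UW (x.1, x.2.2) * probOf p VW x.2 / (probOf p UVW x * probOf p W x.2.2)
  have pointwise (ω : Ω) : p ω * Real.log (probOf p UW (UW ω)) +
      p ω * Real.log (probOf p VW (VW ω)) - p ω * Real.log (probOf p UVW (UVW ω)) -
      p ω * Real.log (probOf p W (W ω)) ≤ p ω * r (UVW ω) - p ω := by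
    rcases (hp ω).eq_or_lt with h | h
    · simp [← h]
    have h₁ := h.trans_le (le_probOf hp UW ω)
    have h₂ := h.trans_le (le_probOf hp VW ω)
    have h₃ := h.trans_le (le_probOf hp UVW ω)
    have h₄ := h.trans_le (le_probOf hp W ω)
    have hr : r (UVW ω) = probOf p UW (UW ω) * probOf p VW (VW ω) /
      (probOf p UVW (UVW ω) * probOf p W (W ω)) := rfl
    have hlog := Real.log_le_sub_one_of_pos (x := r (UVW ω)) (by rw [hr]; positivity)
    have hsplit : Real.log (r (UVW ω)) = Real.log (probOf p UW (UW ω)) +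
        Real.log (probOf p VW (VW ω)) -
        (Real.log (probOf p UVW (UVW ω)) + Real.log (probOf p W (W ω))) := by
      rw [hr, Real.log_div (by positivity) (by positivity), Real.log_mul h₁.ne' h₂.ne',
        Real.log_mul h₃.ne' h₄.ne']
    have := mul_le_mul_of_nonneg_left hlog h.le
    rw [hsplit] at this
    linarith
  have total : ∑ ω, p ω * r (UVW ω) ≤ ∑ ω, p ω := by
    rw [sum_mul_comp_eq_sum_probOf p UVW r]
    calc ∑ x, probOf p UVW x * r x
        ≤ ∑ x : α × β × γ,
            probOf p UW (x.1, x.2.2) * (probOf p VW x.2 / probOf p W x.2.2) := by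
          refine Finset.sum_le_sum fun x _ => ?_
          have h₁ := probOf_nonneg hp UW (x.1, x.2.2)
          have h₂ := probOf_nonneg hp VW x.2
          have h₃ := probOf_nonneg hp W x.2.2
          by_cases h : probOf p UVW x = 0
          · rw [h, zero_mul]; positivity
          · refine le_of_eq ?_
            dsimp only [r]
            rw [mul_div_mul_comm]
            field_simp
      _ = ∑ z : β × γ, probOf p W z.2 * (probOf p VW z / probOf p W z.2) := by
          rw [Fintype.sum_prod_type, Finset.sum_comm]
          exact Finset.sum_congr rfl fun z _ => by
            dsimp only
            rw [← Finset.sum_mul, sum_probOf_pair p U W z.2]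
      _ ≤ ∑ z, probOf p VW z := by
          refine Finset.sum_le_sum fun z _ => ?_
          by_cases h : probOf p W z.2 = 0
          · rw [h, zero_mul]; exact probOf_nonneg hp VW z
          · exact (mul_div_cancel₀ _ h).le
      _ = ∑ ω, p ω := sum_probOf p VW
  have := Finset.sum_le_sum fun ω (_ : ω ∈ Finset.univ) => pointwise ω
  simp only [Finset.sum_sub_distrib, Finset.sum_add_distrib] at this
  simp only [Hent_eq_neg_sum]
  linarith

lemma tup_eq_tup_iff {Ω ι : Type} {𝒳 : ι → Type} (X : ∀ k, Ω → 𝒳 k) (S : Finset ι)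
    (ω ω' : Ω) : tup X S ω = tup X S ω' ↔ ∀ k ∈ S, X k ω = X k ω' := by
  simp [tup, funext_iff]

/-- Subfamilies of a mutually independent family have the product distribution. -/
lemma MutIndep.probOf_tup {Ω ι : Type} [Fintype Ω] [Fintype ι] {𝒳 : ι → Type}
    [∀ k, Fintype (𝒳 k)] {p : Ω → ℝ} (hp : IsPMF p) {X : ∀ k, Ω → 𝒳 k}
    (hind : MutIndep p X) (S : Finset ι) (ω : Ω) :
    probOf p (tup X S) (tup X S ω) = ∏ k ∈ S, probOf p (X k) (X k ω) := by
  let g : ∀ k, 𝒳 k → ℝ := fun k x => if k ∈ S then (if x = X k ω then 1 else 0) else 1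
  have indicator (x : ∀ k, 𝒳 k) :
      ∏ k, g k (x k) = if ∀ k ∈ S, x k = X k ω then 1 else 0 := by
    simp only [g]
    rw [Finset.prod_ite_mem, Finset.univ_inter, Finset.prod_ite_zero]
    simp
  calc probOf p (tup X S) (tup X S ω)
      = ∑ ω', p ω' * ∏ k, g k (X k ω') := by
        refine Finset.sum_congr rfl fun ω' _ => ?_
        rw [indicator fun k => X k ω']
        simp [tup_eq_tup_iff]
    _ = ∑ x : ∀ k, 𝒳 k, probOf p (fun ω k => X k ω) x * ∏ k, g k (x k) :=
        sum_mul_comp_eq_sum_probOf p (fun ω k => X k ω) fun x => ∏ k, g k (x k)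
    _ = ∑ x : ∀ k, 𝒳 k, ∏ k, probOf p (X k) (x k) * g k (x k) := by
        refine Finset.sum_congr rfl fun x _ => ?_
        rw [hind x, Finset.prod_mul_distrib]
    _ = ∏ k, ∑ x, probOf p (X k) x * g k x :=
        (Fintype.prod_sum fun k x => probOf p (X k) x * g k x).symm
    _ = ∏ k, if k ∈ S then probOf p (X k) (X k ω) else 1 := by
        refine Finset.prod_congr rfl fun k _ => ?_
        by_cases h : k ∈ S
        · simp [g, h]
        · simp [g, h, sum_probOf, hp.2]
    _ = ∏ k ∈ S, probOf p (X k) (X k ω) := by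
        rw [Finset.prod_ite_mem, Finset.univ_inter]

/-- The entropy of a subfamily of a mutually independent family is additive. -/
lemma MutIndep.Hent_tup {Ω ι : Type} [Fintype Ω] [Fintype ι] {𝒳 : ι → Type}
    [∀ k, Fintype (𝒳 k)] {p : Ω → ℝ} (hp : IsPMF p) {X : ∀ k, Ω → 𝒳 k}
    (hind : MutIndep p X) (S : Finset ι) [Fintype (∀ k : S, 𝒳 k.1)] :
    Hent p (tup X S) = ∑ k ∈ S, Hent p (X k) := by
  simp only [Hent_eq_neg_sum, hind.probOf_tup hp]
  rw [Finset.sum_neg_distrib, Finset.sum_comm]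
  congr 1
  refine Finset.sum_congr rfl fun ω _ => ?_
  rcases (hp.1 ω).eq_or_lt with h | h
  · simp [← h]
  · rw [Real.log_prod fun k _ => (h.trans_le (le_probOf hp.1 (X k) ω)).ne', Finset.mul_sum]

theorem stmt17 {K : ℕ} {Ω : Type} [Fintype Ω]
    {𝒳 : Fin (K + 1) → Type} [∀ k, Fintype (𝒳 k)] {𝒴 : Type} [Fintype 𝒴]
    (p : Ω → ℝ) (hp : IsPMF p)
    (X : ∀ k, Ω → 𝒳 k) (Y : Ω → 𝒴) (hind : MutIndep p X) :
    ∀ S ⊆ Finset.univ.erase (Fin.last K),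
      IcondMut p (tup X (insert (Fin.last K) S)) Y
          (tup X (Finset.univ.erase (Fin.last K) \ S)) ≤
        IcondMut p (tup X S) Y
            (tup X (insert (Fin.last K) (Finset.univ.erase (Fin.last K) \ S))) +
          IcondMut p (X (Fin.last K)) Y (tup X (Finset.univ.erase (Fin.last K))) := by
  intro S hS
  set l := Fin.last K
  set E := Finset.univ.erase l
  set R := E \ S
  have hlE : l ∉ E := Finset.notMem_erase _ _
  have hlR : l ∉ R := fun h => hlE (Finset.sdiff_subset h)
  have hE (P : Fin (K + 1) → Prop) :
      (∀ k ∈ E, P k) ↔ (∀ k ∈ S, P k) ∧ ∀ k ∈ R, P k := by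
    rw [← Finset.union_sdiff_of_subset hS, Finset.forall_mem_union]
  simp only [IcondMut, condHent]
  rw [Hent_congr p (X := fun ω => (tup X (insert l S) ω, tup X R ω)) (Z := tup X (insert l E)),
    Hent_congr p (X := fun ω => ((tup X (insert l S) ω, Y ω), tup X R ω))
      (Z := fun ω => (X l ω, tup X E ω, Y ω, tup X R ω)),
    Hent_congr p (X := fun ω => (tup X S ω, tup X (insert l R) ω)) (Z := tup X (insert l E)),
    Hent_congr p (X := fun ω => ((tup X S ω, Y ω), tup X (insert l R) ω))
      (Z := fun ω => (X l ω, tup X E ω, Y ω, tup X R ω)),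
    Hent_congr p (X := fun ω => (Y ω, tup X (insert l R) ω))
      (Z := fun ω => (X l ω, Y ω, tup X R ω)),
    Hent_congr p (X := fun ω => (X l ω, tup X E ω)) (Z := tup X (insert l E)),
    Hent_congr p (X := fun ω => ((X l ω, Y ω), tup X E ω))
      (Z := fun ω => (X l ω, tup X E ω, Y ω, tup X R ω)),
    Hent_congr p (X := fun ω => (Y ω, tup X E ω))
      (Z := fun ω => (tup X E ω, Y ω, tup X R ω))]
  · have hsub := Hent_submodular hp.1 (X l) (tup X E) fun ω => (Y ω, tup X R ω)
    have hHE := hind.Hent_tup hp (insert l E)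
    have hHR := hind.Hent_tup hp (insert l R)
    rw [Finset.sum_insert hlE, ← hind.Hent_tup hp] at hHE
    rw [Finset.sum_insert hlR, ← hind.Hent_tup hp] at hHR
    linarith
  all_goals
    intro ω ω'
    simp only [Prod.mk.injEq, tup_eq_tup_iff, Finset.forall_mem_insert, hE] <;> tauto
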